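/- arXiv:solv-int/9701008 — 7 statements merged into one kernel-verified Lean document; each statement's English description precedes it below -/
import Mathlib

section
/- Let K₁, K₂, K₃ : ℝ³ → ℝ be smooth functions of (x, y, t) satisfying the three equations (where ∂ₓ, ∂_y, ∂_t denote partial derivatives): (i) ∂_t K₁ − (∂ₓ³K₁ + 3∂ₓ²K₂ + 3∂ₓK₃) = 3K₁²(∂ₓK₁) − 3K₁(∂ₓ²K₁) − 3(∂ₓK₁)² − 3(∂ₓK₂)K₁ − 3(∂ₓK₁)K₂; (ii) ∂_y K₁ − (∂ₓ²K₁ + 2∂ₓK₂) = −2K₁(∂ₓK₁); (iii) ∂_y K₂ − (∂ₓ²K₂ + 2∂ₓK₃) = −2(∂ₓK₁)K₂. Then the function w := −2K₁ satisfies the potential Kadomtsev–Petviashvili equation ∂ₓ∂_t w = (1/4)∂ₓ⁴w + (3/2)(∂ₓw)(∂ₓ²w) + (3/4)∂_y²w. -/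
noncomputable section

/-- Partial derivative in the first variable `x`. -/
def dx (w : ℝ → ℝ → ℝ → ℝ) : ℝ → ℝ → ℝ → ℝ :=
  fun x y t => deriv (fun s => w s y t) x

/-- Partial derivative in the second variable `y`. -/
def dy (w : ℝ → ℝ → ℝ → ℝ) : ℝ → ℝ → ℝ → ℝ :=
  fun x y t => deriv (fun s => w x s t) y

/-- Partial derivative in the third variable `t`. -/
def dt (w : ℝ → ℝ → ℝ → ℝ) : ℝ → ℝ → ℝ → ℝ :=
  fun x y t => deriv (fun s => w x y s) t

/-- Smoothness of a function of three real variables. -/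
def Smooth3 (w : ℝ → ℝ → ℝ → ℝ) : Prop :=
  ContDiff ℝ (⊤ : ℕ∞) (fun p : ℝ × ℝ × ℝ => w p.1 p.2.1 p.2.2)

/-- The potential Kadomtsev–Petviashvili equation. -/
def PKP (w : ℝ → ℝ → ℝ → ℝ) : Prop :=
  ∀ x y t, dx (dt w) x y t =
      (1/4) * dx (dx (dx (dx w))) x y t
    + (3/2) * dx w x y t * dx (dx w) x y t
    + (3/4) * dy (dy w) x y t

/-- The linearization of the PKP equation at a solution `w`. -/
def LinPKP (w Q : ℝ → ℝ → ℝ → ℝ) : Prop :=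
  ∀ x y t, dx (dt Q) x y t =
      (1/4) * dx (dx (dx (dx Q))) x y t
    + (3/2) * (dx Q x y t * dx (dx w) x y t + dx w x y t * dx (dx Q) x y t)
    + (3/4) * dy (dy Q) x y t

lemma hasDerivAt_fderiv_x {w : ℝ → ℝ → ℝ → ℝ} (h : Smooth3 w) (p : ℝ × ℝ × ℝ) :
    HasDerivAt (fun s => w s p.2.1 p.2.2)
      (fderiv ℝ (fun q : ℝ × ℝ × ℝ => w q.1 q.2.1 q.2.2) p (1, 0, 0)) p.1 := by
  have hd := (ContDiff.differentiable h (by simp) p).hasFDerivAt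
  have hc : HasDerivAt (fun s : ℝ => (s, p.2.1, p.2.2)) ((1 : ℝ), (0 : ℝ), (0 : ℝ)) p.1 :=
    (hasDerivAt_id p.1).prodMk (hasDerivAt_const p.1 (p.2.1, p.2.2))
  exact hd.comp_hasDerivAt p.1 hc

lemma hasDerivAt_fderiv_y {w : ℝ → ℝ → ℝ → ℝ} (h : Smooth3 w) (p : ℝ × ℝ × ℝ) :
    HasDerivAt (fun s => w p.1 s p.2.2)
      (fderiv ℝ (fun q : ℝ × ℝ × ℝ => w q.1 q.2.1 q.2.2) p (0, 1, 0)) p.2.1 := by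
  have hd := (ContDiff.differentiable h (by simp) p).hasFDerivAt
  have hc : HasDerivAt (fun s : ℝ => (p.1, s, p.2.2)) ((0 : ℝ), (1 : ℝ), (0 : ℝ)) p.2.1 :=
    (hasDerivAt_const p.2.1 p.1).prodMk
      ((hasDerivAt_id p.2.1).prodMk (hasDerivAt_const p.2.1 p.2.2))
  exact hd.comp_hasDerivAt p.2.1 hc

lemma Smooth3.hasDerivAt_dx {w : ℝ → ℝ → ℝ → ℝ} (h : Smooth3 w) (x y t : ℝ) :
    HasDerivAt (fun s => w s y t) (dx w x y t) x :=
  (hasDerivAt_fderiv_x h (x, y, t)).differentiableAt.hasDerivAt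

lemma Smooth3.hasDerivAt_dy {w : ℝ → ℝ → ℝ → ℝ} (h : Smooth3 w) (x y t : ℝ) :
    HasDerivAt (fun s => w x s t) (dy w x y t) y :=
  (hasDerivAt_fderiv_y h (x, y, t)).differentiableAt.hasDerivAt

lemma Smooth3.dx_uncurry {w : ℝ → ℝ → ℝ → ℝ} (h : Smooth3 w) :
    (fun p : ℝ × ℝ × ℝ => dx w p.1 p.2.1 p.2.2) =
      fun p => fderiv ℝ (fun q : ℝ × ℝ × ℝ => w q.1 q.2.1 q.2.2) p (1, 0, 0) :=
  funext fun p => (hasDerivAt_fderiv_x h p).deriv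

lemma Smooth3.dy_uncurry {w : ℝ → ℝ → ℝ → ℝ} (h : Smooth3 w) :
    (fun p : ℝ × ℝ × ℝ => dy w p.1 p.2.1 p.2.2) =
      fun p => fderiv ℝ (fun q : ℝ × ℝ × ℝ => w q.1 q.2.1 q.2.2) p (0, 1, 0) :=
  funext fun p => (hasDerivAt_fderiv_y h p).deriv

lemma Smooth3.contDiff_fderiv {w : ℝ → ℝ → ℝ → ℝ} (h : Smooth3 w) :
    ContDiff ℝ (⊤ : ℕ∞) (fderiv ℝ (fun q : ℝ × ℝ × ℝ => w q.1 q.2.1 q.2.2)) :=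
  ContDiff.fderiv_right h (by simp)

lemma Smooth3.dx {w : ℝ → ℝ → ℝ → ℝ} (h : Smooth3 w) : Smooth3 (dx w) := by
  rw [Smooth3, h.dx_uncurry]
  exact h.contDiff_fderiv.clm_apply contDiff_const

lemma Smooth3.dy {w : ℝ → ℝ → ℝ → ℝ} (h : Smooth3 w) : Smooth3 (dy w) := by
  rw [Smooth3, h.dy_uncurry]
  exact h.contDiff_fderiv.clm_apply contDiff_const

lemma Smooth3.dy_dx {w : ℝ → ℝ → ℝ → ℝ} (h : Smooth3 w) :
    _root_.dy (_root_.dx w) = _root_.dx (_root_.dy w) := by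
  ext x y t
  have hd := h.contDiff_fderiv.differentiable (by simp) (x, y, t)
  have hs : IsSymmSndFDerivAt ℝ (fun q : ℝ × ℝ × ℝ => w q.1 q.2.1 q.2.2) (x, y, t) :=
    (ContDiff.contDiffAt h).isSymmSndFDerivAt
      (by simpa using WithTop.coe_le_coe.2 (le_top : (2 : ℕ∞) ≤ ⊤))
  have e1 := (hasDerivAt_fderiv_y h.dx (x, y, t)).deriv
  have e2 := (hasDerivAt_fderiv_x h.dy (x, y, t)).deriv
  rw [h.dx_uncurry, fderiv_clm_apply hd (by fun_prop)] at e1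
  rw [h.dy_uncurry, fderiv_clm_apply hd (by fun_prop)] at e2
  refine e1.trans (Eq.trans ?_ e2.symm)
  simpa using hs.eq (0, 1, 0) (1, 0, 0)

lemma dx_const_mul (c : ℝ) (w : ℝ → ℝ → ℝ → ℝ) :
    dx (fun x y t => c * w x y t) = fun x y t => c * dx w x y t := by
  ext x y t
  exact deriv_const_mul_field c

lemma dy_const_mul (c : ℝ) (w : ℝ → ℝ → ℝ → ℝ) :
    dy (fun x y t => c * w x y t) = fun x y t => c * dy w x y t := by
  ext x y t
  exact deriv_const_mul_field c

lemma dt_const_mul (c : ℝ) (w : ℝ → ℝ → ℝ → ℝ) :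
    dt (fun x y t => c * w x y t) = fun x y t => c * dt w x y t := by
  ext x y t
  exact deriv_const_mul_field c

/-- If `K₁, K₂, K₃` are smooth and satisfy the first equations of the KP hierarchy,
then `w = −2K₁` satisfies the potential KP equation. -/
theorem stmt0 (K1 K2 K3 : ℝ → ℝ → ℝ → ℝ)
    (hK1 : Smooth3 K1) (hK2 : Smooth3 K2) (hK3 : Smooth3 K3)
    (h1 : ∀ x y t,
      dt K1 x y t - (dx (dx (dx K1)) x y t + 3 * dx (dx K2) x y t + 3 * dx K3 x y t)
        = 3 * (K1 x y t) ^ 2 * dx K1 x y t - 3 * K1 x y t * dx (dx K1) x y t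
          - 3 * (dx K1 x y t) ^ 2 - 3 * dx K2 x y t * K1 x y t - 3 * dx K1 x y t * K2 x y t)
    (h2 : ∀ x y t,
      dy K1 x y t - (dx (dx K1) x y t + 2 * dx K2 x y t) = -2 * K1 x y t * dx K1 x y t)
    (h3 : ∀ x y t,
      dy K2 x y t - (dx (dx K2) x y t + 2 * dx K3 x y t) = -2 * dx K1 x y t * K2 x y t) :
    PKP (fun x y t => -2 * K1 x y t) := by
  have ht : dt K1 = fun x y t => dx (dx (dx K1)) x y t + 3 * dx (dx K2) x y t + 3 * dx K3 x y t
      + 3 * ((K1 x y t * K1 x y t) * dx K1 x y t) - 3 * (K1 x y t * dx (dx K1) x y t)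
      - 3 * (dx K1 x y t * dx K1 x y t) - 3 * (dx K2 x y t * K1 x y t)
      - 3 * (dx K1 x y t * K2 x y t) := by
    ext x y t
    linear_combination h1 x y t
  have hy1 : dy K1 = fun x y t => dx (dx K1) x y t + 2 * dx K2 x y t
      - 2 * (K1 x y t * dx K1 x y t) := by
    ext x y t
    linear_combination h2 x y t
  have hy2 : dy K2 = fun x y t => dx (dx K2) x y t + 2 * dx K3 x y t
      - 2 * (dx K1 x y t * K2 x y t) := by
    ext x y t
    linear_combination h3 x y t
  have hxt (x y t : ℝ) := by
    have := ((((((((hK1.dx.dx.dx.hasDerivAt_dx x y t).add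
      ((hK2.dx.dx.hasDerivAt_dx x y t).const_mul 3)).add
      ((hK3.dx.hasDerivAt_dx x y t).const_mul 3)).add
      ((((hK1.hasDerivAt_dx x y t).mul (hK1.hasDerivAt_dx x y t)).mul
        (hK1.dx.hasDerivAt_dx x y t)).const_mul 3)).sub
      (((hK1.hasDerivAt_dx x y t).mul (hK1.dx.dx.hasDerivAt_dx x y t)).const_mul 3)).sub
      (((hK1.dx.hasDerivAt_dx x y t).mul (hK1.dx.hasDerivAt_dx x y t)).const_mul 3)).sub
      (((hK2.dx.hasDerivAt_dx x y t).mul (hK1.hasDerivAt_dx x y t)).const_mul 3)).sub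
      (((hK1.dx.hasDerivAt_dx x y t).mul (hK2.hasDerivAt_dx x y t)).const_mul 3)).deriv
    exact (congrFun (congrFun (congrFun (congrArg dx ht) x) y) t).trans this
  have hxy1 : dx (dy K1) = fun x y t => dx (dx (dx K1)) x y t + 2 * dx (dx K2) x y t
      - 2 * (dx K1 x y t * dx K1 x y t + K1 x y t * dx (dx K1) x y t) := by
    rw [hy1]
    ext x y t
    exact (((hK1.dx.dx.hasDerivAt_dx x y t).add
      ((hK2.dx.hasDerivAt_dx x y t).const_mul 2)).sub
      (((hK1.hasDerivAt_dx x y t).mul (hK1.dx.hasDerivAt_dx x y t)).const_mul 2)).deriv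
  have hxxy1 (x y t : ℝ) : dx (dx (dy K1)) x y t =
      dx (dx (dx (dx K1))) x y t + 2 * dx (dx (dx K2)) x y t
      - 2 * ((dx (dx K1) x y t * dx K1 x y t + dx K1 x y t * dx (dx K1) x y t)
        + (dx K1 x y t * dx (dx K1) x y t + K1 x y t * dx (dx (dx K1)) x y t)) := by
    rw [hxy1]
    exact (((hK1.dx.dx.dx.hasDerivAt_dx x y t).add
      ((hK2.dx.dx.hasDerivAt_dx x y t).const_mul 2)).sub
      ((((hK1.dx.hasDerivAt_dx x y t).mul (hK1.dx.hasDerivAt_dx x y t)).add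
        ((hK1.hasDerivAt_dx x y t).mul (hK1.dx.dx.hasDerivAt_dx x y t))).const_mul 2)).deriv
  have hxy2 (x y t : ℝ) : dx (dy K2) x y t =
      dx (dx (dx K2)) x y t + 2 * dx (dx K3) x y t
      - 2 * (dx (dx K1) x y t * K2 x y t + dx K1 x y t * dx K2 x y t) := by
    rw [hy2]
    exact (((hK2.dx.dx.hasDerivAt_dx x y t).add
      ((hK3.dx.hasDerivAt_dx x y t).const_mul 2)).sub
      (((hK1.dx.hasDerivAt_dx x y t).mul (hK2.hasDerivAt_dx x y t)).const_mul 2)).deriv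
  have hyy (x y t : ℝ) : dy (dy K1) x y t =
      dx (dx (dy K1)) x y t + 2 * dx (dy K2) x y t
      - 2 * (dy K1 x y t * dx K1 x y t + K1 x y t * dx (dy K1) x y t) := by
    rw [← hK1.dy_dx, ← hK1.dx.dy_dx, ← hK2.dy_dx]
    exact (congrFun (congrFun (congrFun (congrArg dy hy1) x) y) t).trans
      (((hK1.dx.dx.hasDerivAt_dy x y t).add
      ((hK2.dx.hasDerivAt_dy x y t).const_mul 2)).sub
      (((hK1.hasDerivAt_dy x y t).mul (hK1.dx.hasDerivAt_dy x y t)).const_mul 2)).deriv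
  intro x y t
  simp only [dx_const_mul, dy_const_mul, dt_const_mul]
  rw [hyy, hxxy1, hxy2, hxt, hxy1, hy1]
  simp only [Pi.mul_apply]
  ring
end
end

section
/- For all smooth g₁, g₂ : ℝ → ℝ, the Lie bracket of the vector fields Y(g₁) and Y(g₂) on ℝ⁴ satisfies [Y(g₁), Y(g₂)] = (2/3)·X(g₁g₂' − g₁'g₂) pointwise. -/
noncomputable section

/-- The space ℝ⁴, with coordinates (x, y, t, w). -/
abbrev E : Type := ℝ × ℝ × ℝ × ℝ

/-- Lie bracket of vector fields on ℝ⁴: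
`[V, W](p) = DW(p)(V(p)) − DV(p)(W(p))`. -/
def lie (V W : E → E) : E → E :=
  fun p => fderiv ℝ W p (V p) - fderiv ℝ V p (W p)

/-- The Virasoro vector field `T(f)`. -/
def Tf (f : ℝ → ℝ) : E → E := fun p =>
  ((1/3) * p.1 * deriv f p.2.2.1 + (2/9) * p.2.1 ^ 2 * deriv (deriv f) p.2.2.1,
   (2/3) * p.2.1 * deriv f p.2.2.1,
   f p.2.2.1,
   -((1/3) * p.2.2.2 * deriv f p.2.2.1 + (1/9) * p.1 ^ 2 * deriv (deriv f) p.2.2.1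
     + (4/27) * p.1 * p.2.1 ^ 2 * deriv (deriv (deriv f)) p.2.2.1
     + (4/243) * p.2.1 ^ 4 * deriv (deriv (deriv (deriv f))) p.2.2.1))

/-- The Kac–Moody vector field `Y(g)`. -/
def Yf (g : ℝ → ℝ) : E → E := fun p =>
  ((2/3) * p.2.1 * deriv g p.2.2.1,
   g p.2.2.1,
   0,
   -((4/9) * p.1 * p.2.1 * deriv (deriv g) p.2.2.1
     + (8/81) * p.2.1 ^ 3 * deriv (deriv (deriv g)) p.2.2.1))

/-- The Kac–Moody vector field `X(h)`. -/
def Xf (h : ℝ → ℝ) : E → E := fun p =>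
  (h p.2.2.1, 0, 0, -((2/3) * p.1 * deriv h p.2.2.1 + (4/9) * p.2.1 ^ 2 * deriv (deriv h) p.2.2.1))

/-- The Kac–Moody vector field `W(k)`. -/
def Wf (k : ℝ → ℝ) : E → E := fun p =>
  (0, 0, 0, p.2.1 * k p.2.2.1)

/-- The Kac–Moody vector field `U(ℓ)`. -/
def Uf (l : ℝ → ℝ) : E → E := fun p =>
  (0, 0, 0, l p.2.2.1)

lemma hasDerivAt_of_smooth {g : ℝ → ℝ} (hg : ContDiff ℝ (⊤ : ℕ∞) g) (t : ℝ) :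
    HasDerivAt g (deriv g t) t :=
  ((hg.differentiable (by simp)) t).hasDerivAt

lemma contDiff_deriv_of_smooth {g : ℝ → ℝ} (hg : ContDiff ℝ (⊤ : ℕ∞) g) :
    ContDiff ℝ (⊤ : ℕ∞) (deriv g) :=
  (contDiff_infty_iff_deriv.1 hg).2

/-- The total derivative of `Y(g)` at `p`, applied to a vector `v`. -/
lemma fderiv_Yf_apply {g : ℝ → ℝ} (hg : ContDiff ℝ (⊤ : ℕ∞) g) (p v : E) :
    fderiv ℝ (Yf g) p v =
      ((2/3) * (v.2.1 * deriv g p.2.2.1 + p.2.1 * (deriv (deriv g) p.2.2.1 * v.2.2.1)),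
       deriv g p.2.2.1 * v.2.2.1,
       0,
       -((4/9) * ((v.1 * p.2.1 + p.1 * v.2.1) * deriv (deriv g) p.2.2.1
            + p.1 * p.2.1 * (deriv (deriv (deriv g)) p.2.2.1 * v.2.2.1))
         + (8/81) * (3 * p.2.1 ^ 2 * v.2.1 * deriv (deriv (deriv g)) p.2.2.1
            + p.2.1 ^ 3 * (deriv (deriv (deriv (deriv g))) p.2.2.1 * v.2.2.1)))) := by
  have hg1 := contDiff_deriv_of_smooth hg
  have hg2 := contDiff_deriv_of_smooth hg1
  have hg3 := contDiff_deriv_of_smooth hg2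
  have hx : HasFDerivAt (fun q : E => q.1) (ContinuousLinearMap.fst ℝ ℝ (ℝ × ℝ × ℝ)) p :=
    hasFDerivAt_fst
  have hs : HasFDerivAt (fun q : E => q.2) (ContinuousLinearMap.snd ℝ ℝ (ℝ × ℝ × ℝ)) p :=
    hasFDerivAt_snd
  have hy : HasFDerivAt (fun q : E => q.2.1) _ p := hs.fst
  have ht : HasFDerivAt (fun q : E => q.2.2.1) _ p := hs.snd.fst
  have h0 := (hasDerivAt_of_smooth hg p.2.2.1).comp_hasFDerivAt p ht
  have h1 := (hasDerivAt_of_smooth hg1 p.2.2.1).comp_hasFDerivAt p ht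
  have h2 := (hasDerivAt_of_smooth hg2 p.2.2.1).comp_hasFDerivAt p ht
  have h3 := (hasDerivAt_of_smooth hg3 p.2.2.1).comp_hasFDerivAt p ht
  have H : HasFDerivAt (Yf g) _ p :=
    ((hy.const_mul (2/3)).mul h1).prodMk (h0.prodMk ((hasFDerivAt_const (0 : ℝ) p).prodMk
      ((((hx.const_mul (4/9)).mul hy).mul h2).add (((hy.pow 3).const_mul (8/81)).mul h3)).neg))
  rw [H.fderiv]
  ext <;> simp <;> ring

lemma deriv_wronskian {g₁ g₂ : ℝ → ℝ} (hg₁ : ContDiff ℝ (⊤ : ℕ∞) g₁)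
    (hg₂ : ContDiff ℝ (⊤ : ℕ∞) g₂) :
    deriv (fun t => g₁ t * deriv g₂ t - deriv g₁ t * g₂ t)
      = fun t => g₁ t * deriv (deriv g₂) t - deriv (deriv g₁) t * g₂ t := by
  funext t
  have hd₁ := hasDerivAt_of_smooth (contDiff_deriv_of_smooth hg₁) t
  have hd₂ := hasDerivAt_of_smooth (contDiff_deriv_of_smooth hg₂) t
  refine ((((hasDerivAt_of_smooth hg₁ t).mul hd₂).sub
    (hd₁.mul (hasDerivAt_of_smooth hg₂ t))).congr_deriv ?_).deriv
  ring

lemma deriv_deriv_wronskian {g₁ g₂ : ℝ → ℝ} (hg₁ : ContDiff ℝ (⊤ : ℕ∞) g₁)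
    (hg₂ : ContDiff ℝ (⊤ : ℕ∞) g₂) (t : ℝ) :
    deriv (deriv (fun t => g₁ t * deriv g₂ t - deriv g₁ t * g₂ t)) t
      = deriv g₁ t * deriv (deriv g₂) t + g₁ t * deriv (deriv (deriv g₂)) t
        - (deriv (deriv (deriv g₁)) t * g₂ t + deriv (deriv g₁) t * deriv g₂ t) := by
  rw [deriv_wronskian hg₁ hg₂]
  have hd₁ := contDiff_deriv_of_smooth (contDiff_deriv_of_smooth hg₁)
  have hd₂ := contDiff_deriv_of_smooth (contDiff_deriv_of_smooth hg₂)
  exact (((hasDerivAt_of_smooth hg₁ t).mul (hasDerivAt_of_smooth hd₂ t)).sub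
    ((hasDerivAt_of_smooth hd₁ t).mul (hasDerivAt_of_smooth hg₂ t))).deriv

/-- `[Y(g₁), Y(g₂)] = (2/3)·X(g₁g₂' − g₁'g₂)`. -/
theorem stmt6 (g₁ g₂ : ℝ → ℝ) (hg₁ : ContDiff ℝ (⊤ : ℕ∞) g₁) (hg₂ : ContDiff ℝ (⊤ : ℕ∞) g₂) :
    ∀ p : E, lie (Yf g₁) (Yf g₂) p
      = (2/3 : ℝ) • Xf (fun t => g₁ t * deriv g₂ t - deriv g₁ t * g₂ t) p := by
  intro p
  simp only [lie, fderiv_Yf_apply hg₁, fderiv_Yf_apply hg₂, Xf]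
  rw [deriv_deriv_wronskian hg₁ hg₂, deriv_wronskian hg₁ hg₂]
  ext <;> simp [Yf] <;> ring
end
end

section
/- For all smooth g, k : ℝ → ℝ, the Lie bracket of the vector fields Y(g) and W(k) on ℝ⁴ satisfies [Y(g), W(k)] = U(g·k) pointwise. -/
noncomputable section

/-- `Y(g)` does not depend on the last coordinate, so its derivative kills vertical vectors. -/
theorem fderiv_Yf_vertical (g : ℝ → ℝ) (p : E) (c : ℝ) :
    fderiv ℝ (Yf g) p (0, 0, 0, c) = 0 := by
  by_cases h : DifferentiableAt ℝ (Yf g) p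
  · rw [← h.lineDeriv_eq_fderiv]
    simp [lineDeriv, Yf]
  · simp [fderiv_zero_of_not_differentiableAt h]

/-- The derivative of `W(k)` along a vector whose `t`-component vanishes. -/
theorem fderiv_Wf_apply {k : ℝ → ℝ} (hk : Differentiable ℝ k) (p : E) (a b c : ℝ) :
    fderiv ℝ (Wf k) p (a, b, 0, c) = (0, 0, 0, b * k p.2.2.1) := by
  have h : DifferentiableAt ℝ (Wf k) p := by
    unfold Wf
    fun_prop
  rw [← h.lineDeriv_eq_fderiv]
  refine HasDerivAt.deriv (?_ : HasDerivAt _ _ _)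
  have hb : HasDerivAt (fun s : ℝ => (p.2.1 + s * b) * k p.2.2.1) (b * k p.2.2.1) 0 := by
    simpa using (((hasDerivAt_id (0 : ℝ)).mul_const b).const_add p.2.1).mul_const (k p.2.2.1)
  have h0 : HasDerivAt (fun _ : ℝ => (0 : ℝ)) 0 0 := hasDerivAt_const _ _
  simpa [Wf] using h0.prodMk (h0.prodMk (h0.prodMk hb))

/-- `[Y(g), W(k)] = U(g·k)`. -/
theorem stmt8 (g k : ℝ → ℝ) (hg : ContDiff ℝ (⊤ : ℕ∞) g) (hk : ContDiff ℝ (⊤ : ℕ∞) k) :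
    ∀ p : E, lie (Yf g) (Wf k) p = Uf (fun t => g t * k t) p := by
  intro p
  change fderiv ℝ (Wf k) p (Yf g p) - fderiv ℝ (Yf g) p (Wf k p) = _
  have hk' : Differentiable ℝ k := hk.differentiable (by simp)
  rw [Yf, fderiv_Wf_apply hk', Wf, fderiv_Yf_vertical, sub_zero, Uf]
end
end

section
/- For all smooth h₁, h₂ : ℝ → ℝ, the Lie bracket of the vector fields X(h₁) and X(h₂) on ℝ⁴ satisfies [X(h₁), X(h₂)] = −(2/3)·U(h₁h₂' − h₁'h₂) pointwise. -/
noncomputable section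

theorem differentiable_Xf {h : ℝ → ℝ} (hh : ContDiff ℝ (⊤ : ℕ∞) h) :
    Differentiable ℝ (Xf h) := by
  have h' : ContDiff ℝ (⊤ : ℕ∞) (deriv h) := (contDiff_infty_iff_deriv.mp hh).2
  have d₀ : Differentiable ℝ h := (contDiff_infty_iff_deriv.mp hh).1
  have d₁ : Differentiable ℝ (deriv h) := (contDiff_infty_iff_deriv.mp h').1
  have d₂ : Differentiable ℝ (deriv (deriv h)) :=
    (contDiff_infty_iff_deriv.mp (contDiff_infty_iff_deriv.mp h').2).1
  unfold Xf
  fun_prop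

/-- `X(h)` is affine along every direction in the `(x, w)`-plane. -/
theorem fderiv_Xf_apply {h : ℝ → ℝ} (hh : ContDiff ℝ (⊤ : ℕ∞) h) (p : E) (a b : ℝ) :
    fderiv ℝ (Xf h) p (a, 0, 0, b) = (0, 0, 0, -((2/3) * a * deriv h p.2.2.1)) := by
  rw [← (differentiable_Xf hh p).lineDeriv_eq_fderiv]
  refine HasLineDerivAt.lineDeriv ?_
  have affine : (fun s : ℝ => Xf h (p + s • ((a, 0, 0, b) : E)))
      = fun s : ℝ => Xf h p + s • ((0, 0, 0, -((2/3) * a * deriv h p.2.2.1)) : E) := by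
    funext s
    simp only [Xf, Prod.fst_add, Prod.snd_add, Prod.smul_fst, Prod.smul_snd, smul_eq_mul,
      mul_zero, add_zero]
    ext <;> simp
    ring
  unfold HasLineDerivAt
  rw [affine]
  simpa only [id_eq, one_smul] using ((hasDerivAt_id (0 : ℝ)).smul_const
    ((0, 0, 0, -((2/3) * a * deriv h p.2.2.1)) : E)).const_add (Xf h p)

/-- `[X(h₁), X(h₂)] = −(2/3)·U(h₁h₂' − h₁'h₂)`. -/
theorem stmt9 (h₁ h₂ : ℝ → ℝ) (hh₁ : ContDiff ℝ (⊤ : ℕ∞) h₁) (hh₂ : ContDiff ℝ (⊤ : ℕ∞) h₂) :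
    ∀ p : E, lie (Xf h₁) (Xf h₂) p
      = -(2/3 : ℝ) • Uf (fun t => h₁ t * deriv h₂ t - deriv h₁ t * h₂ t) p := by
  intro p
  change fderiv ℝ (Xf h₂) p (h₁ p.2.2.1, 0, 0, _)
    - fderiv ℝ (Xf h₁) p (h₂ p.2.2.1, 0, 0, _) = _
  rw [fderiv_Xf_apply hh₂, fderiv_Xf_apply hh₁]
  ext <;> simp [Uf]
  ring
end
end

section
/- For all smooth f, g : ℝ → ℝ, the Lie bracket of the vector fields T(f) and Y(g) on ℝ⁴ satisfies [T(f), Y(g)] = Y(f·g' − (2/3)f'·g) pointwise. -/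
noncomputable section

lemma differentiable_iterate_deriv {f : ℝ → ℝ} (hf : ContDiff ℝ (⊤ : ℕ∞) f) (n : ℕ) :
    Differentiable ℝ (deriv^[n] f) :=
  (hf.iterate_deriv n).differentiable (by simp)

/-- The differential of a function of `t`, pulled back to ℝ⁴. -/
lemma hasFDerivAt_comp_t {φ : ℝ → ℝ} (hφ : Differentiable ℝ φ) (p : E) :
    HasFDerivAt (fun q : E => φ q.2.2.1)
      (deriv φ p.2.2.1 • (ContinuousLinearMap.fst ℝ ℝ ℝ).comp
        ((ContinuousLinearMap.snd ℝ ℝ (ℝ × ℝ)).comp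
          (ContinuousLinearMap.snd ℝ ℝ (ℝ × ℝ × ℝ)))) p :=
  (hφ p.2.2.1).hasDerivAt.comp_hasFDerivAt p hasFDerivAt_snd.snd.fst

lemma hasFDerivAt_x (p : E) :
    HasFDerivAt (fun q : E => q.1) (ContinuousLinearMap.fst ℝ ℝ (ℝ × ℝ × ℝ)) p :=
  hasFDerivAt_fst

lemma hasFDerivAt_y (p : E) :
    HasFDerivAt (fun q : E => q.2.1) ((ContinuousLinearMap.fst ℝ ℝ (ℝ × ℝ)).comp
      (ContinuousLinearMap.snd ℝ ℝ (ℝ × ℝ × ℝ))) p :=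
  hasFDerivAt_snd.fst

lemma hasFDerivAt_w (p : E) :
    HasFDerivAt (fun q : E => q.2.2.2) ((ContinuousLinearMap.snd ℝ ℝ ℝ).comp
      ((ContinuousLinearMap.snd ℝ ℝ (ℝ × ℝ)).comp
        (ContinuousLinearMap.snd ℝ ℝ (ℝ × ℝ × ℝ)))) p :=
  hasFDerivAt_snd.snd.snd

lemma fderiv_Tf {f : ℝ → ℝ} (hf : ContDiff ℝ (⊤ : ℕ∞) f) (x y t w a b c d : ℝ) :
    fderiv ℝ (Tf f) (x, y, t, w) (a, b, c, d) =
      ((1/3) * (a * deriv f t + x * deriv (deriv f) t * c)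
          + (2/9) * (2 * y * b * deriv (deriv f) t + y ^ 2 * deriv (deriv (deriv f)) t * c),
        (2/3) * (b * deriv f t + y * deriv (deriv f) t * c),
        deriv f t * c,
        -((1/3) * (d * deriv f t + w * deriv (deriv f) t * c)
          + (1/9) * (2 * x * a * deriv (deriv f) t + x ^ 2 * deriv (deriv (deriv f)) t * c)
          + (4/27) * ((a * y ^ 2 + x * (2 * y * b)) * deriv (deriv (deriv f)) t
            + x * y ^ 2 * deriv (deriv (deriv (deriv f))) t * c)
          + (4/243) * (4 * y ^ 3 * b * deriv (deriv (deriv (deriv f))) t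
            + y ^ 4 * deriv (deriv (deriv (deriv (deriv f)))) t * c))) := by
  set p : E := (x, y, t, w)
  have hx := hasFDerivAt_x p
  have hy := hasFDerivAt_y p
  have hw := hasFDerivAt_w p
  have h0 := hasFDerivAt_comp_t (differentiable_iterate_deriv hf 0) p
  have h1 := hasFDerivAt_comp_t (differentiable_iterate_deriv hf 1) p
  have h2 := hasFDerivAt_comp_t (differentiable_iterate_deriv hf 2) p
  have h3 := hasFDerivAt_comp_t (differentiable_iterate_deriv hf 3) p
  have h4 := hasFDerivAt_comp_t (differentiable_iterate_deriv hf 4) p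
  have h : HasFDerivAt (Tf f) _ p :=
    (((hx.const_mul (1/3)).mul h1).add (((hy.pow 2).const_mul (2/9)).mul h2)).prodMk
      (((hy.const_mul (2/3)).mul h1).prodMk
        (h0.prodMk
          (((((hw.const_mul (1/3)).mul h1).add (((hx.pow 2).const_mul (1/9)).mul h2)).add
            (((hx.const_mul (4/27)).mul (hy.pow 2)).mul h3)).add
              (((hy.pow 4).const_mul (4/243)).mul h4)).neg))
  rw [h.fderiv]
  simp only [ContinuousLinearMap.prod_apply, Prod.mk.injEq]
  simp [p]
  refine ⟨?_, ?_, ?_⟩ <;> ring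

lemma fderiv_Yf {g : ℝ → ℝ} (hg : ContDiff ℝ (⊤ : ℕ∞) g) (x y t w a b c d : ℝ) :
    fderiv ℝ (Yf g) (x, y, t, w) (a, b, c, d) =
      ((2/3) * (b * deriv g t + y * deriv (deriv g) t * c),
        deriv g t * c,
        0,
        -((4/9) * ((a * y + x * b) * deriv (deriv g) t + x * y * deriv (deriv (deriv g)) t * c)
          + (8/81) * (3 * y ^ 2 * b * deriv (deriv (deriv g)) t
            + y ^ 3 * deriv (deriv (deriv (deriv g))) t * c))) := by
  set p : E := (x, y, t, w)
  have hx := hasFDerivAt_x p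
  have hy := hasFDerivAt_y p
  have h0 := hasFDerivAt_comp_t (differentiable_iterate_deriv hg 0) p
  have h1 := hasFDerivAt_comp_t (differentiable_iterate_deriv hg 1) p
  have h2 := hasFDerivAt_comp_t (differentiable_iterate_deriv hg 2) p
  have h3 := hasFDerivAt_comp_t (differentiable_iterate_deriv hg 3) p
  have h : HasFDerivAt (Yf g) _ p :=
    ((hy.const_mul (2/3)).mul h1).prodMk
      (h0.prodMk
        ((hasFDerivAt_const (0 : ℝ) p).prodMk
          ((((hx.const_mul (4/9)).mul hy).mul h2).add
            (((hy.pow 3).const_mul (8/81)).mul h3)).neg))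
  rw [h.fderiv]
  simp only [ContinuousLinearMap.prod_apply, Prod.mk.injEq]
  simp [p]
  refine ⟨?_, ?_⟩ <;> ring

lemma deriv_mul_deriv_sub {f g : ℝ → ℝ} (hf : ContDiff ℝ (⊤ : ℕ∞) f)
    (hg : ContDiff ℝ (⊤ : ℕ∞) g) :
    deriv (fun t => f t * deriv g t - (2/3) * deriv f t * g t) =
      fun t => f t * deriv (deriv g) t + (1/3) * deriv f t * deriv g t
        - (2/3) * deriv (deriv f) t * g t := by
  funext t
  have f0 := (differentiable_iterate_deriv hf 0 t).hasDerivAt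
  have f1 := (differentiable_iterate_deriv hf 1 t).hasDerivAt
  have g0 := (differentiable_iterate_deriv hg 0 t).hasDerivAt
  have g1 := (differentiable_iterate_deriv hg 1 t).hasDerivAt
  refine ((f0.mul g1).sub ((f1.const_mul (2/3)).mul g0)).deriv.trans ?_
  simp only [Function.iterate_succ, Function.iterate_zero, Function.comp_apply, id_eq]
  ring

lemma deriv_deriv_mul_deriv_sub {f g : ℝ → ℝ} (hf : ContDiff ℝ (⊤ : ℕ∞) f)
    (hg : ContDiff ℝ (⊤ : ℕ∞) g) :
    deriv (deriv (fun t => f t * deriv g t - (2/3) * deriv f t * g t)) =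
      fun t => f t * deriv (deriv (deriv g)) t + (4/3) * deriv f t * deriv (deriv g) t
        - (1/3) * deriv (deriv f) t * deriv g t - (2/3) * deriv (deriv (deriv f)) t * g t := by
  rw [deriv_mul_deriv_sub hf hg]
  funext t
  have f0 := (differentiable_iterate_deriv hf 0 t).hasDerivAt
  have f1 := (differentiable_iterate_deriv hf 1 t).hasDerivAt
  have f2 := (differentiable_iterate_deriv hf 2 t).hasDerivAt
  have g0 := (differentiable_iterate_deriv hg 0 t).hasDerivAt
  have g1 := (differentiable_iterate_deriv hg 1 t).hasDerivAt
  have g2 := (differentiable_iterate_deriv hg 2 t).hasDerivAt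
  refine (((f0.mul g2).add ((f1.const_mul (1/3)).mul g1)).sub
    ((f2.const_mul (2/3)).mul g0)).deriv.trans ?_
  simp only [Function.iterate_succ, Function.iterate_zero, Function.comp_apply, id_eq]
  ring

lemma deriv_deriv_deriv_mul_deriv_sub {f g : ℝ → ℝ} (hf : ContDiff ℝ (⊤ : ℕ∞) f)
    (hg : ContDiff ℝ (⊤ : ℕ∞) g) :
    deriv (deriv (deriv (fun t => f t * deriv g t - (2/3) * deriv f t * g t))) =
      fun t => f t * deriv (deriv (deriv (deriv g))) t
        + (7/3) * deriv f t * deriv (deriv (deriv g)) t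
        + deriv (deriv f) t * deriv (deriv g) t
        - deriv (deriv (deriv f)) t * deriv g t
        - (2/3) * deriv (deriv (deriv (deriv f))) t * g t := by
  rw [deriv_deriv_mul_deriv_sub hf hg]
  funext t
  have f0 := (differentiable_iterate_deriv hf 0 t).hasDerivAt
  have f1 := (differentiable_iterate_deriv hf 1 t).hasDerivAt
  have f2 := (differentiable_iterate_deriv hf 2 t).hasDerivAt
  have f3 := (differentiable_iterate_deriv hf 3 t).hasDerivAt
  have g0 := (differentiable_iterate_deriv hg 0 t).hasDerivAt
  have g1 := (differentiable_iterate_deriv hg 1 t).hasDerivAt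
  have g2 := (differentiable_iterate_deriv hg 2 t).hasDerivAt
  have g3 := (differentiable_iterate_deriv hg 3 t).hasDerivAt
  refine ((((f0.mul g3).add ((f1.const_mul (4/3)).mul g2)).sub
    ((f2.const_mul (1/3)).mul g1)).sub ((f3.const_mul (2/3)).mul g0)).deriv.trans ?_
  simp only [Function.iterate_succ, Function.iterate_zero, Function.comp_apply, id_eq]
  ring

/-- `[T(f), Y(g)] = Y(f·g' − (2/3)f'·g)`. -/
theorem stmt10 (f g : ℝ → ℝ) (hf : ContDiff ℝ (⊤ : ℕ∞) f) (hg : ContDiff ℝ (⊤ : ℕ∞) g) :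
    ∀ p : E, lie (Tf f) (Yf g) p
      = Yf (fun t => f t * deriv g t - (2/3) * deriv f t * g t) p := by
  rintro ⟨x, y, t, w⟩
  rw [lie, show Tf f (x, y, t, w) = (_, _, _, _) from rfl,
    show Yf g (x, y, t, w) = (_, _, _, _) from rfl, fderiv_Tf hf, fderiv_Yf hg]
  rw [Yf, deriv_deriv_deriv_mul_deriv_sub hf hg, deriv_deriv_mul_deriv_sub hf hg,
    deriv_mul_deriv_sub hf hg]
  simp only [Prod.mk_sub_mk, Prod.mk.injEq]
  refine ⟨?_, ?_, ?_, ?_⟩ <;> ring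
end
end

section
/- For all smooth f, ℓ : ℝ → ℝ, the Lie bracket of the vector fields T(f) and U(ℓ) on ℝ⁴ satisfies [T(f), U(ℓ)] = U(f·ℓ' + (1/3)f'·ℓ) pointwise. -/
noncomputable section

theorem fderiv_Uf {l : ℝ → ℝ} (hl : Differentiable ℝ l) (p v : E) :
    fderiv ℝ (Uf l) p v = (0, 0, 0, deriv l p.2.2.1 * v.2.2.1) := by
  have hU : Differentiable ℝ (Uf l) := by
    unfold Uf
    fun_prop
  rw [← (hU p).lineDeriv_eq_fderiv]
  refine HasDerivAt.deriv ?_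
  have ht : HasDerivAt (fun s : ℝ => p.2.2.1 + s * v.2.2.1) v.2.2.1 0 := by
    simpa using ((hasDerivAt_id (0 : ℝ)).mul_const v.2.2.1).const_add p.2.2.1
  have h := (hl (p.2.2.1 + 0 * v.2.2.1)).hasDerivAt.comp 0 ht
  have h0 : HasDerivAt (fun _ : ℝ => (0 : ℝ)) 0 0 := hasDerivAt_const _ _
  simp only [zero_mul, add_zero] at h
  exact h0.prodMk (h0.prodMk (h0.prodMk h))

theorem differentiable_Tf {f : ℝ → ℝ} (hf : ContDiff ℝ (⊤ : ℕ∞) f) :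
    Differentiable ℝ (Tf f) := by
  have h1 := (contDiff_infty_iff_deriv.1 hf).2
  have h2 := (contDiff_infty_iff_deriv.1 h1).2
  have h3 := (contDiff_infty_iff_deriv.1 h2).2
  have h4 := (contDiff_infty_iff_deriv.1 h3).2
  have d0 := (contDiff_infty_iff_deriv.1 hf).1
  have d1 := (contDiff_infty_iff_deriv.1 h1).1
  have d2 := (contDiff_infty_iff_deriv.1 h2).1
  have d3 := (contDiff_infty_iff_deriv.1 h3).1
  have d4 := (contDiff_infty_iff_deriv.1 h4).1
  unfold Tf
  fun_prop

/-- The derivative of `Tf f` in the direction of the `w`-axis. -/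
theorem fderiv_Tf_vertical {f : ℝ → ℝ} (hf : ContDiff ℝ (⊤ : ℕ∞) f) (p : E) (c : ℝ) :
    fderiv ℝ (Tf f) p (0, 0, 0, c) = (0, 0, 0, -((1/3) * c * deriv f p.2.2.1)) := by
  rw [← (differentiable_Tf hf p).lineDeriv_eq_fderiv]
  refine HasDerivAt.deriv ?_
  have key : (fun s : ℝ => Tf f (p + s • ((0, 0, 0, c) : E))) =
      fun s : ℝ => Tf f p + s • ((0, 0, 0, -((1/3) * c * deriv f p.2.2.1)) : E) := by
    funext s
    simp only [Tf, Prod.smul_mk, Prod.fst_add, Prod.snd_add, Prod.mk_add_mk, smul_eq_mul,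
      mul_zero, add_zero, Prod.mk.injEq, true_and]
    ring
  rw [key]
  simpa using ((hasDerivAt_id (0 : ℝ)).smul_const
    ((0, 0, 0, -((1/3) * c * deriv f p.2.2.1)) : E)).const_add (Tf f p)

/-- `[T(f), U(ℓ)] = U(f·ℓ' + (1/3)f'·ℓ)`. -/
theorem stmt13 (f l : ℝ → ℝ) (hf : ContDiff ℝ (⊤ : ℕ∞) f) (hl : ContDiff ℝ (⊤ : ℕ∞) l) :
    ∀ p : E, lie (Tf f) (Uf l) p
      = Uf (fun t => f t * deriv l t + (1/3) * deriv f t * l t) p := by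
  intro p
  have hT : fderiv ℝ (Tf f) p (Uf l p) = _ := fderiv_Tf_vertical hf p (l p.2.2.1)
  rw [lie, hT, fderiv_Uf (contDiff_infty_iff_deriv.1 hl).1]
  simp only [Uf, Tf, Prod.mk_sub_mk, sub_zero, Prod.mk.injEq, true_and]
  ring
end
end

section
/- The subalgebra spanned by the fields Y, X, W, U is nilpotent: if A₁, A₂, A₃, A₄, A₅ are vector fields on ℝ⁴, each of the form Y(g), X(h), W(k) or U(ℓ) for some smooth function g, h, k or ℓ, then the iterated Lie bracket [A₁, [A₂, [A₃, [A₄, A₅]]]] vanishes identically. -/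
noncomputable section

/-- A vector field belonging to the span of the fields `Y, X, W, U`. -/
def InNilpotent (A : E → E) : Prop :=
  ∃ φ : ℝ → ℝ, ContDiff ℝ (⊤ : ℕ∞) φ ∧ (A = Yf φ ∨ A = Xf φ ∨ A = Wf φ ∨ A = Uf φ)

/-- A vector field on ℝ⁴ without `t`-component whose other components are polynomials in `x, y`
with coefficients depending on `t`. With the weights `1, 2, 0, 4` for `y, x, t, w`, it has
only components of negative weight. -/
def negWeightField (a b c d e f g h i : ℝ → ℝ) : E → E := fun p =>
  (a p.2.2.1 * p.2.1 + e p.2.2.1, b p.2.2.1, 0,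
   c p.2.2.1 * p.1 * p.2.1 + d p.2.2.1 * p.2.1 ^ 3 + f p.2.2.1 * p.1 + g p.2.2.1 * p.2.1 ^ 2
    + h p.2.2.1 * p.2.1 + i p.2.2.1)

section

variable {a b c d e f g h i : ℝ → ℝ}

lemma fderiv_negWeightField_apply (ha : Differentiable ℝ a) (hb : Differentiable ℝ b)
    (hc : Differentiable ℝ c) (hd : Differentiable ℝ d) (he : Differentiable ℝ e)
    (hf : Differentiable ℝ f) (hg : Differentiable ℝ g) (hh : Differentiable ℝ h)
    (hi : Differentiable ℝ i) (x y t w u v z : ℝ) :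
    fderiv ℝ (negWeightField a b c d e f g h i) (x, y, t, w) (u, v, 0, z) =
      (a t * v, 0, 0, (c t * y + f t) * u
        + (c t * x + 3 * d t * y ^ 2 + 2 * g t * y + h t) * v) := by
  have hdiff : Differentiable ℝ (negWeightField a b c d e f g h i) := by
    unfold negWeightField
    fun_prop
  rw [← (hdiff (x, y, t, w)).lineDeriv_eq_fderiv]
  refine HasLineDerivAt.lineDeriv ?_
  have hx : HasDerivAt (fun s : ℝ => x + s * u) u 0 := by
    simpa using ((hasDerivAt_id (0 : ℝ)).mul_const u).const_add x
  have hy : HasDerivAt (fun s : ℝ => y + s * v) v 0 := by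
    simpa using ((hasDerivAt_id (0 : ℝ)).mul_const v).const_add y
  have h₁ := (hy.const_mul (a t)).add_const (e t)
  have h₄ := ((((((hx.const_mul (c t)).mul hy).add ((hy.pow 3).const_mul (d t))).add
    (hx.const_mul (f t))).add ((hy.pow 2).const_mul (g t))).add
    (hy.const_mul (h t))).add_const (i t)
  have key := h₁.prodMk ((hasDerivAt_const (0 : ℝ) (b t)).prodMk
    ((hasDerivAt_const (0 : ℝ) (0 : ℝ)).prodMk h₄))
  refine (key.congr_deriv ?_).congr_of_eventuallyEq (.of_forall fun s => ?_)
  · simp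
    ring
  · simp [negWeightField]

variable {a' b' c' d' e' f' g' h' i' : ℝ → ℝ}

lemma lie_negWeightField (ha : Differentiable ℝ a) (hb : Differentiable ℝ b)
    (hc : Differentiable ℝ c) (hd : Differentiable ℝ d) (he : Differentiable ℝ e)
    (hf : Differentiable ℝ f) (hg : Differentiable ℝ g) (hh : Differentiable ℝ h)
    (hi : Differentiable ℝ i)
    (ha' : Differentiable ℝ a') (hb' : Differentiable ℝ b')
    (hc' : Differentiable ℝ c') (hd' : Differentiable ℝ d') (he' : Differentiable ℝ e')
    (hf' : Differentiable ℝ f') (hg' : Differentiable ℝ g') (hh' : Differentiable ℝ h')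
    (hi' : Differentiable ℝ i') :
    lie (negWeightField a b c d e f g h i) (negWeightField a' b' c' d' e' f' g' h' i') =
      negWeightField 0 0 0 0 (a' * b - a * b') (c' * b - c * b')
        (c' * a + 3 * d' * b - (c * a' + 3 * d * b'))
        (c' * e + f' * a + 2 * g' * b - (c * e' + f * a' + 2 * g * b'))
        (f' * e + h' * b - (f * e' + h * b')) := by
  funext ⟨x, y, t, w⟩
  unfold lie
  rw [show negWeightField a b c d e f g h i (x, y, t, w) = (_, _, 0, _) from rfl,
    show negWeightField a' b' c' d' e' f' g' h' i' (x, y, t, w) = (_, _, 0, _) from rfl,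
    fderiv_negWeightField_apply ha hb hc hd he hf hg hh hi,
    fderiv_negWeightField_apply ha' hb' hc' hd' he' hf' hg' hh' hi']
  simp [negWeightField]
  ring

end

lemma InNilpotent.exists_eq_negWeightField {A : E → E} (hA : InNilpotent A) :
    ∃ a b c d e f g h i : ℝ → ℝ, Differentiable ℝ a ∧ Differentiable ℝ b ∧ Differentiable ℝ c ∧
      Differentiable ℝ d ∧ Differentiable ℝ e ∧ Differentiable ℝ f ∧ Differentiable ℝ g ∧
      Differentiable ℝ h ∧ Differentiable ℝ i ∧ A = negWeightField a b c d e f g h i := by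
  obtain ⟨φ, hφ, hA⟩ := hA
  have hφ₁ : ContDiff ℝ (⊤ : ℕ∞) (deriv φ) := (contDiff_infty_iff_deriv.1 hφ).2
  have hφ₂ : ContDiff ℝ (⊤ : ℕ∞) (deriv (deriv φ)) := (contDiff_infty_iff_deriv.1 hφ₁).2
  have hφ₃ := (contDiff_infty_iff_deriv.1 hφ₂).2
  have D₀ : Differentiable ℝ φ := hφ.differentiable (by simp)
  have D₁ : Differentiable ℝ (deriv φ) := hφ₁.differentiable (by simp)
  have D₂ : Differentiable ℝ (deriv (deriv φ)) := hφ₂.differentiable (by simp)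
  have D₃ : Differentiable ℝ (deriv (deriv (deriv φ))) := hφ₃.differentiable (by simp)
  have Z : Differentiable ℝ (0 : ℝ → ℝ) := differentiable_const 0
  rcases hA with rfl | rfl | rfl | rfl
  · refine ⟨fun t => (2/3) * deriv φ t, φ, fun t => -(4/9) * deriv (deriv φ) t,
      fun t => -(8/81) * deriv (deriv (deriv φ)) t, 0, 0, 0, 0, 0,
      by fun_prop, D₀, by fun_prop, by fun_prop, Z, Z, Z, Z, Z, ?_⟩
    funext p
    simp [Yf, negWeightField]
    constructor <;> ring
  · refine ⟨0, 0, 0, 0, φ, fun t => -(2/3) * deriv φ t, fun t => -(4/9) * deriv (deriv φ) t,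
      0, 0, Z, Z, Z, Z, D₀, by fun_prop, by fun_prop, Z, Z, ?_⟩
    funext p
    simp [Xf, negWeightField]
    ring
  · refine ⟨0, 0, 0, 0, 0, 0, 0, φ, 0, Z, Z, Z, Z, Z, Z, Z, D₀, Z, ?_⟩
    funext p
    simp [Wf, negWeightField]
    ring
  · refine ⟨0, 0, 0, 0, 0, 0, 0, 0, φ, Z, Z, Z, Z, Z, Z, Z, Z, D₀, ?_⟩
    funext p
    simp [Uf, negWeightField]

/-- The subalgebra spanned by `Y, X, W, U` is nilpotent: any 5-fold iterated bracket
vanishes identically. -/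
theorem stmt14 (A₁ A₂ A₃ A₄ A₅ : E → E)
    (h₁ : InNilpotent A₁) (h₂ : InNilpotent A₂) (h₃ : InNilpotent A₃)
    (h₄ : InNilpotent A₄) (h₅ : InNilpotent A₅) :
    ∀ p : E, lie A₁ (lie A₂ (lie A₃ (lie A₄ A₅))) p = 0 := by
  obtain ⟨a₁, b₁, c₁, d₁, e₁, f₁, g₁, k₁, i₁, _, _, _, _, _, _, _, _, _, rfl⟩ :=
    h₁.exists_eq_negWeightField
  obtain ⟨a₂, b₂, c₂, d₂, e₂, f₂, g₂, k₂, i₂, _, _, _, _, _, _, _, _, _, rfl⟩ :=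
    h₂.exists_eq_negWeightField
  obtain ⟨a₃, b₃, c₃, d₃, e₃, f₃, g₃, k₃, i₃, _, _, _, _, _, _, _, _, _, rfl⟩ :=
    h₃.exists_eq_negWeightField
  obtain ⟨a₄, b₄, c₄, d₄, e₄, f₄, g₄, k₄, i₄, _, _, _, _, _, _, _, _, _, rfl⟩ :=
    h₄.exists_eq_negWeightField
  obtain ⟨a₅, b₅, c₅, d₅, e₅, f₅, g₅, k₅, i₅, _, _, _, _, _, _, _, _, _, rfl⟩ :=
    h₅.exists_eq_negWeightField
  have Z : Differentiable ℝ (0 : ℝ → ℝ) := differentiable_const 0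
  have C₂ : Differentiable ℝ (2 : ℝ → ℝ) := differentiable_const 2
  have C₃ : Differentiable ℝ (3 : ℝ → ℝ) := differentiable_const 3
  intro p
  rw [lie_negWeightField (a := a₄), lie_negWeightField (a := a₃), lie_negWeightField (a := a₂),
    lie_negWeightField (a := a₁)]
  · simp [negWeightField]
  all_goals fun_prop
end
end
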